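/- Let q ≥ 2 be a prime power, m ≥ 1 and n ≥ 2 integers. Let V be a fixed subspace of 𝔽_q^m with dim V = d, and let V1, …, V_{n−1} be mutually independent uniformly random subspaces of 𝔽_q^m of dimensions d1, …, d_{n−1} respectively (all dimensions between 0 and m). Set d* := min( d, max(0, d1 + ⋯ + d_{n−1} + d − m) ). Then for every integer k ≥ 1, P( |dim((V1 + ⋯ + V_{n−1}) ∩ V) − d*| ≥ k ) ≤ n · q^{−k/n}. -/

import Mathlib

open Finset in
theorem aux_transitive {F E : Type} [Field F] [Fintype F] [AddCommGroup E] [Module F E] [Fintype E]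
    {x y : E} (hx : x ≠ 0) (hy : y ≠ 0) : ∃ g : E ≃ₗ[F] E, g x = y := by
  let f := (LinearEquiv.toSpanNonzeroSingleton F E x hx).symm ≪≫ₗ
    LinearEquiv.toSpanNonzeroSingleton F E y hy
  obtain ⟨g, hg⟩ := Submodule.exists_linearEquiv_restrict_eq f
  refine ⟨g, ?_⟩
  have h := hg ⟨x, Submodule.mem_span_singleton_self x⟩
  rw [← h]
  have h1 : (LinearEquiv.toSpanNonzeroSingleton F E x hx).symm
      ⟨x, Submodule.mem_span_singleton_self x⟩ = 1 := by
    rw [LinearEquiv.symm_apply_eq]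
    ext
    simp
  simp only [f, LinearEquiv.trans_apply, h1]
  simp

open Classical in
theorem aux_count {F E : Type} [Field F] [Fintype F] [AddCommGroup E] [Module F E] [Fintype E]
    (S : Finset (Submodule F E)) (w : ℕ) (hS : ∀ W, W ∈ S ↔ Module.finrank F W = w) :
    ∃ c : ℝ, ∀ T : Submodule F E,
      ∑ W ∈ S, ((Fintype.card F : ℝ) ^ (Module.finrank F ↥(T ⊓ W)) - 1) =
        ((Fintype.card F : ℝ) ^ (Module.finrank F T) - 1) * c := by
  have hcard : ∀ T : Submodule F E,
      ((Fintype.card F : ℝ) ^ (Module.finrank F T) - 1) =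
      ∑ x : E, if x ∈ T ∧ x ≠ 0 then (1 : ℝ) else 0 := by
    intro T
    have h1 : (Fintype.card F : ℝ) ^ (Module.finrank F T) = Fintype.card T := by
      rw [Module.card_eq_pow_finrank (K := F) (V := T)]
      push_cast; rfl
    rw [h1, Finset.sum_boole]
    have h2 : Fintype.card T = (Finset.univ.filter (fun x : E => x ∈ T)).card :=
      Fintype.card_subtype _
    have h3 : Finset.univ.filter (fun x : E => x ∈ T ∧ x ≠ 0)
        = (Finset.univ.filter (fun x : E => x ∈ T)).erase 0 := by
      ext x; simp [and_comm]
    rw [h3, Finset.cast_card_erase_of_mem (by simp), h2]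
  have hconst : ∃ c : ℝ, ∀ x : E, x ≠ 0 → ((S.filter (fun W => x ∈ W)).card : ℝ) = c := by
    by_cases h : ∃ y : E, y ≠ 0
    · obtain ⟨y, hy⟩ := h
      refine ⟨((S.filter (fun W => y ∈ W)).card : ℝ), fun x hx => ?_⟩
      obtain ⟨g, hg⟩ := aux_transitive (F := F) hx hy
      congr 1
      refine Finset.card_bij' (fun W _ => W.map (g : E →ₗ[F] E))
        (fun W _ => W.map (g.symm : E →ₗ[F] E)) ?_ ?_ ?_ ?_
      · intro W hW
        simp only [Finset.mem_filter, hS] at hW ⊢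
        refine ⟨?_, ?_⟩
        · rw [LinearEquiv.finrank_map_eq]; exact hW.1
        · rw [← hg]; exact Submodule.mem_map_of_mem hW.2
      · intro W hW
        simp only [Finset.mem_filter, hS] at hW ⊢
        refine ⟨?_, ?_⟩
        · rw [LinearEquiv.finrank_map_eq]; exact hW.1
        · have : x = g.symm y := by rw [← hg]; simp
          rw [this]; exact Submodule.mem_map_of_mem hW.2
      · intro W _
        ext z; simp
      · intro W _
        ext z; simp
    · refine ⟨0, fun x hx => absurd ⟨x, hx⟩ h⟩
  obtain ⟨c, hc⟩ := hconst
  refine ⟨c, fun T => ?_⟩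
  simp only [hcard]
  rw [Finset.sum_comm, Finset.sum_mul]
  refine Finset.sum_congr rfl fun x _ => ?_
  by_cases hx : x ∈ T ∧ x ≠ 0
  · rw [if_pos hx, one_mul, ← hc x hx.2, ← Finset.sum_boole]
    refine Finset.sum_congr rfl fun W _ => ?_
    simp [hx.1, hx.2]
  · rw [if_neg hx, zero_mul]
    refine Finset.sum_eq_zero fun W _ => ?_
    rw [if_neg]
    rintro ⟨h1, h2⟩
    exact hx ⟨h1.1, h2⟩

theorem aux_step {F E : Type} [Field F] [Fintype F] [AddCommGroup E] [Module F E] [Fintype E]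
    (S : Finset (Submodule F E)) (w : ℕ) (hS : ∀ W, W ∈ S ↔ Module.finrank F W = w)
    (U : Submodule F E) (hm : 1 ≤ Module.finrank F E) :
    ∑ W ∈ S, (Fintype.card F : ℝ) ^
      (min (Module.finrank F E) (Module.finrank F U + w) - Module.finrank F ↥(U ⊔ W))
      ≤ 2 * S.card := by
  rcases S.eq_empty_or_nonempty with rfl | ⟨W0, hW0⟩
  · simp
  have hwm : w ≤ Module.finrank F E := by
    rw [← (hS W0).1 hW0]; exact Submodule.finrank_le W0
  have hum : Module.finrank F U ≤ Module.finrank F E := Submodule.finrank_le U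
  have hq : (2 : ℝ) ≤ Fintype.card F := by exact_mod_cast Fintype.one_lt_card (α := F)
  obtain ⟨c, hc⟩ := aux_count S w hS
  have hU := hc U
  have hT := hc ⊤
  have hT' : ∑ W ∈ S, ((Fintype.card F : ℝ) ^ (Module.finrank F ↥((⊤ : Submodule F E) ⊓ W)) - 1)
      = S.card * ((Fintype.card F : ℝ) ^ w - 1) := by
    rw [← nsmul_eq_mul, ← Finset.sum_const]
    refine Finset.sum_congr rfl fun W hW => ?_
    rw [top_inf_eq, (hS W).1 hW]
  rw [hT', finrank_top] at hT
  rw [Finset.sum_sub_distrib, Finset.sum_const, nsmul_eq_mul, mul_one] at hU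
  set u := Module.finrank F U with hu
  set m := Module.finrank F E with hmm
  set q : ℝ := ((Fintype.card F : ℕ) : ℝ) with hqq
  have hq1 : (1 : ℝ) ≤ q := by linarith
  have hX : ∀ W ∈ S, q ^ (min m (u + w) - Module.finrank F ↥(U ⊔ W)) * q ^ (u + w - m)
      = q ^ (Module.finrank F ↥(U ⊓ W)) := by
    intro W hW
    rw [← pow_add]
    congr 1
    have h1 := Submodule.finrank_sup_add_finrank_inf_eq U W
    have h2 : Module.finrank F ↥(U ⊔ W) ≤ m := Submodule.finrank_le _
    rw [(hS W).1 hW, ← hu] at h1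
    omega
  rw [← Finset.sum_congr rfl hX, ← Finset.sum_mul] at hU
  set A := ∑ W ∈ S, q ^ (min m (u + w) - Module.finrank F ↥(U ⊔ W)) with hA
  have hD1 : (1 : ℝ) ≤ q ^ (u + w - m) := one_le_pow₀ hq1
  have hu1 : (1 : ℝ) ≤ q ^ u := one_le_pow₀ hq1
  have hw1 : (1 : ℝ) ≤ q ^ w := one_le_pow₀ hq1
  have hm2 : (2 : ℝ) ≤ q ^ m := by
    calc (2 : ℝ) ≤ q := hq
      _ = q ^ 1 := by ring
      _ ≤ q ^ m := pow_le_pow_right₀ hq1 hm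
  have hkey : (q ^ u - 1) * (q ^ w - 1) ≤ q ^ (u + w - m) * (q ^ m - 1) := by
    rcases le_total (u + w) m with h | h
    · have h0 : u + w - m = 0 := by omega
      have h1 : q ^ u * q ^ w ≤ q ^ m := by
        rw [← pow_add]; exact pow_le_pow_right₀ hq1 h
      rw [h0, pow_zero]
      nlinarith
    · have h1 : q ^ (u + w - m) * q ^ m = q ^ u * q ^ w := by
        rw [← pow_add, ← pow_add]; congr 1; omega
      have h2 : q ^ (u + w - m) ≤ q ^ u := pow_le_pow_right₀ hq1 (by omega)
      nlinarith
  have hs : (0 : ℝ) ≤ S.card := Nat.cast_nonneg _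
  -- (A q^D - s)(q^m-1) = (q^u-1) c (q^m-1) = (q^u-1)(q^w-1) s
  have h1 : (A * q ^ (u + w - m) - S.card) * (q ^ m - 1)
      = (q ^ u - 1) * (q ^ w - 1) * S.card := by
    rw [hU]; linear_combination (-(q ^ u - 1)) * hT
  have h2 : (A * q ^ (u + w - m) - S.card) * (q ^ m - 1)
      ≤ (q ^ (u + w - m) * S.card) * (q ^ m - 1) := by
    rw [h1]; nlinarith [mul_le_mul_of_nonneg_right hkey hs]
  have h3 := le_of_mul_le_mul_right h2 (by linarith)
  have h4 : A * q ^ (u + w - m) ≤ (2 * S.card) * q ^ (u + w - m) := by nlinarith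
  exact le_of_mul_le_mul_right h4 (by linarith)

theorem aux_main {F E : Type} [Field F] [Fintype F] [AddCommGroup E] [Module F E] [Fintype E]
    (hm : 1 ≤ Module.finrank F E)
    (S : ℕ → Finset (Submodule F E)) (hS : ∀ w W, W ∈ S w ↔ Module.finrank F W = w) (N : ℕ) :
    ∀ (dv : Fin N → ℕ) (U : Submodule F E),
    ∑ W ∈ Fintype.piFinset (fun i => S (dv i)), (Fintype.card F : ℝ) ^
      (min (Module.finrank F E) (Module.finrank F U + ∑ i, dv i)
        - Module.finrank F ↥(U ⊔ ⨆ i, W i))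
      ≤ 2 ^ N * (Fintype.piFinset (fun i => S (dv i))).card := by
  have hq1 : (1 : ℝ) ≤ Fintype.card F := by exact_mod_cast (Fintype.one_lt_card (α := F)).le
  induction N with
  | zero =>
    intro dv U
    have h0 : ∀ W : Fin 0 → Submodule F E, min (Module.finrank F E)
        (Module.finrank F U + ∑ i, dv i) - Module.finrank F ↥(U ⊔ ⨆ i, W i) = 0 := by
      intro W
      rw [iSup_of_empty, sup_bot_eq]
      simp
    simp only [h0]
    simp
  | succ N ih =>
    intro dv U
    have hsum : ∀ f : (Fin (N + 1) → Submodule F E) → ℝ,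
        ∑ W ∈ Fintype.piFinset (fun i => S (dv i)), f W =
        ∑ W0 ∈ S (dv 0), ∑ W ∈ Fintype.piFinset (fun i : Fin N => S (dv i.succ)),
          f (Fin.cons W0 W) := by
      intro f
      rw [← Finset.sum_product']
      refine Finset.sum_bij' (fun W _ => (W 0, Fin.tail W)) (fun p _ => Fin.cons p.1 p.2)
        ?_ ?_ ?_ ?_ ?_
      · intro W hW
        rw [Fin.mem_piFinset_iff_zero_tail] at hW
        exact Finset.mem_product.2 hW
      · intro p hp
        rw [Fin.mem_piFinset_iff_zero_tail]
        exact Finset.mem_product.1 hp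
      · intro W _; simp
      · intro p _; simp
      · intro W _; simp
    have hc : ((Fintype.piFinset (fun i => S (dv i))).card : ℝ) =
        (S (dv 0)).card * (Fintype.piFinset (fun i : Fin N => S (dv i.succ))).card := by
      have := hsum (fun _ => 1)
      simpa using this
    rw [hsum, hc]
    have hstep := aux_step (S (dv 0)) (dv 0) (hS (dv 0)) U hm
    set C : ℝ := (((Fintype.piFinset (fun i : Fin N => S (dv i.succ))).card : ℕ) : ℝ) with hC
    calc _ ≤ ∑ W0 ∈ S (dv 0), (Fintype.card F : ℝ) ^
            (min (Module.finrank F E) (Module.finrank F U + dv 0) - Module.finrank F ↥(U ⊔ W0))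
            * (2 ^ N * C) := by
          refine Finset.sum_le_sum fun W0 _ => ?_
          refine le_trans ?_ (mul_le_mul_of_nonneg_left (ih (fun i => dv i.succ) (U ⊔ W0))
            (by positivity))
          rw [Finset.mul_sum]
          refine Finset.sum_le_sum fun W _ => ?_
          rw [← pow_add]
          refine pow_le_pow_right₀ hq1 ?_
          have h1 : U ⊔ ⨆ i, (Fin.cons W0 W : Fin (N + 1) → Submodule F E) i
              = U ⊔ W0 ⊔ ⨆ i, W i := by
            rw [sup_assoc]
            congr 1
            apply le_antisymm
            · refine iSup_le fun i => ?_
              refine Fin.cases ?_ (fun j => ?_) i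
              · exact le_sup_left
              · exact le_sup_of_le_right (le_iSup W j)
            · refine sup_le ?_ (iSup_le fun j => ?_)
              · exact le_iSup (Fin.cons W0 W : Fin (N + 1) → Submodule F E) 0
              · exact le_iSup (Fin.cons W0 W : Fin (N + 1) → Submodule F E) j.succ
          rw [h1, Fin.sum_univ_succ]
          have h2 : Module.finrank F ↥(U ⊔ W0) ≤ Module.finrank F E := Submodule.finrank_le _
          omega
      _ = (∑ W0 ∈ S (dv 0), (Fintype.card F : ℝ) ^
            (min (Module.finrank F E) (Module.finrank F U + dv 0) - Module.finrank F ↥(U ⊔ W0)))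
            * (2 ^ N * C) := by rw [Finset.sum_mul]
      _ ≤ (2 * (S (dv 0)).card) * (2 ^ N * C) :=
          mul_le_mul_of_nonneg_right hstep (by positivity)
      _ = _ := by ring

theorem aux_finrank_iSup_le {F E : Type} [Field F] [Fintype F] [AddCommGroup E] [Module F E]
    [Fintype E] (N : ℕ) (W : Fin N → Submodule F E) :
    Module.finrank F ↥(⨆ i, W i) ≤ ∑ i, Module.finrank F (W i) := by
  rw [← Finset.sup_univ_eq_iSup]
  generalize (Finset.univ : Finset (Fin N)) = s
  induction s using Finset.induction_on with
  | empty => simp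
  | insert a s ha ih =>
    rw [Finset.sup_insert, Finset.sum_insert ha]
    exact (Submodule.finrank_add_le_finrank_add_finrank _ _).trans (by omega)

theorem aux_num (q n k : ℕ) (hq : 2 ≤ q) (hn : 2 ≤ n) (P : ℝ) (h1 : P ≤ 1)
    (h2 : P * (q : ℝ) ^ k ≤ 2 ^ n) : P ≤ (n : ℝ) * (q : ℝ) ^ (-(k : ℝ) / n) := by
  have hq0 : (0 : ℝ) < q := by positivity
  have hn0 : (0 : ℝ) < n := by positivity
  have hn2 : (2 : ℝ) ≤ n := by exact_mod_cast hn
  set x : ℝ := (q : ℝ) ^ ((k : ℝ) / n) with hx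
  have hx0 : 0 < x := Real.rpow_pos_of_pos hq0 _
  have hxn : x ^ n = (q : ℝ) ^ k := by
    rw [hx, ← Real.rpow_natCast, ← Real.rpow_mul hq0.le, div_mul_cancel₀ _ hn0.ne',
      Real.rpow_natCast]
  have hneg : (q : ℝ) ^ (-(k : ℝ) / n) = x⁻¹ := by
    rw [neg_div, Real.rpow_neg hq0.le]
  rw [hneg, ← div_eq_mul_inv, le_div_iff₀ hx0]
  rcases le_total x n with h | h
  · nlinarith
  · rw [← hxn] at h2
    obtain ⟨j, rfl⟩ : ∃ j, n = j + 1 := ⟨n - 1, by omega⟩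
    have hj : (2 : ℝ) ^ j ≤ x ^ j := pow_le_pow_left₀ (by norm_num) (hn2.trans h) j
    have hj0 : (0 : ℝ) < x ^ j := by positivity
    have h3 : (P * x) * x ^ j ≤ (j + 1 : ℕ) * x ^ j := by
      calc (P * x) * x ^ j = P * x ^ (j + 1) := by ring
        _ ≤ 2 ^ (j + 1) := h2
        _ = 2 * 2 ^ j := by ring
        _ ≤ _ := mul_le_mul hn2 hj (by positivity) (by positivity)
    exact le_of_mul_le_mul_right h3 hj0


/-- Proposition 3, Eq. (12): for a fixed subspace `V` of `𝔽_q^m` of dimension `d`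
and mutually independent uniformly random subspaces `V1, …, V_{n-1}` of dimensions
`d1, …, d_{n-1}`, with `d* = min d (max 0 (d1 + ⋯ + d_{n-1} + d - m))`,
`P(|dim((V1 + ⋯ + V_{n-1}) ⊓ V) - d*| ≥ k) ≤ n * q^(-k/n)`.
The joint (independent, uniform) distribution of the tuple is the uniform
distribution over all tuples of subspaces of the prescribed dimensions. -/
theorem stmt_2 (q m n : ℕ) (hq2 : 2 ≤ q) (hm : 1 ≤ m) (hn : 2 ≤ n)
    (F : Type) [Field F] [Fintype F] (hq : Fintype.card F = q)
    (d : ℕ) (hd : d ≤ m) (V : Submodule F (Fin m → F)) (hV : Module.finrank F V = d)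
    (dv : Fin (n - 1) → ℕ) (hdv : ∀ i, dv i ≤ m)
    (k : ℕ) (hk : 1 ≤ k) :
    (Nat.card {W : Fin (n - 1) → Submodule F (Fin m → F) //
        (∀ i, Module.finrank F (W i) = dv i) ∧
        (k : ℤ) ≤ |(Module.finrank F ↥((⨆ i, W i) ⊓ V) : ℤ) -
          min (d : ℤ) (max 0 ((∑ i, (dv i : ℤ)) + d - m))|} : ℝ) /
      (Nat.card {W : Fin (n - 1) → Submodule F (Fin m → F) //
        ∀ i, Module.finrank F (W i) = dv i} : ℝ) ≤
      (n : ℝ) * (q : ℝ) ^ (-(k : ℝ) / n) := by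
  classical
  have : Finite (Submodule F (Fin m → F)) :=
    Finite.of_injective (fun W : Submodule F (Fin m → F) => (W : Set (Fin m → F)))
      SetLike.coe_injective
  let _ : Fintype (Submodule F (Fin m → F)) := Fintype.ofFinite _
  set S : ℕ → Finset (Submodule F (Fin m → F)) :=
    fun w => Finset.univ.filter (fun W => Module.finrank F W = w) with hSdef
  have hS : ∀ w W, W ∈ S w ↔ Module.finrank F W = w := by intro w W; simp [hSdef]
  have hE : Module.finrank F (Fin m → F) = m := by simp
  set T := Fintype.piFinset (fun i => S (dv i)) with hT
  have hTmem : ∀ W, W ∈ T ↔ ∀ i, Module.finrank F (W i) = dv i := by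
    intro W; simp [hT, hS]
  set p : (Fin (n - 1) → Submodule F (Fin m → F)) → Prop := fun W =>
    (k : ℤ) ≤ |(Module.finrank F ↥((⨆ i, W i) ⊓ V) : ℤ) -
          min (d : ℤ) (max 0 ((∑ i, (dv i : ℤ)) + d - m))| with hp
  have hden : Nat.card {W : Fin (n - 1) → Submodule F (Fin m → F) //
        ∀ i, Module.finrank F (W i) = dv i} = T.card :=
    Nat.subtype_card T hTmem
  have hnum : Nat.card {W : Fin (n - 1) → Submodule F (Fin m → F) //
        (∀ i, Module.finrank F (W i) = dv i) ∧ p W} = (T.filter p).card :=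
    Nat.subtype_card (T.filter p) (fun W => by simp [hTmem])
  have hq0 : (1 : ℝ) ≤ q := by exact_mod_cast (by omega : 1 ≤ q)
  have hA := aux_main (F := F) (by rw [hE]; exact hm) S hS (n - 1) dv ⊥
  have hB := aux_main (F := F) (by rw [hE]; exact hm) S hS (n - 1) dv V
  rw [← hT, hE, hq] at hA hB
  rw [hV] at hB
  rw [finrank_bot] at hA
  have hpt : ∀ W ∈ T.filter p, (q : ℝ) ^ k ≤
      (q : ℝ) ^ (min m (0 + ∑ i, dv i) - Module.finrank F ↥(⊥ ⊔ ⨆ i, W i)) +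
      (q : ℝ) ^ (min m (d + ∑ i, dv i) - Module.finrank F ↥(V ⊔ ⨆ i, W i)) := by
    intro W hW
    rw [Finset.mem_filter, hTmem] at hW
    obtain ⟨hW1, hW2⟩ := hW
    simp only [hp] at hW2
    have h1 := Submodule.finrank_sup_add_finrank_inf_eq V (⨆ i, W i)
    have h2 : Module.finrank F ↥(V ⊔ ⨆ i, W i) ≤ m :=
      (Submodule.finrank_le _).trans hE.le
    have h2' : Module.finrank F ↥(⨆ i, W i) ≤ m :=
      (Submodule.finrank_le _).trans hE.le
    have h3 := aux_finrank_iSup_le _ W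
    rw [Finset.sum_congr rfl (fun i _ => hW1 i)] at h3
    rw [bot_sup_eq]
    rw [inf_comm] at hW2
    rw [hV] at h1
    have hcast : (∑ i, (dv i : ℤ)) = ((∑ i, dv i : ℕ) : ℤ) := by push_cast; rfl
    rw [hcast] at hW2
    generalize (∑ i, dv i) = s at *
    have hor : k ≤ min m (0 + s) - Module.finrank F ↥(⨆ i, W i) ∨
        k ≤ min m (d + s) - Module.finrank F ↥(V ⊔ ⨆ i, W i) := by
      rw [le_abs] at hW2
      omega
    rcases hor with h | h
    · exact (pow_le_pow_right₀ hq0 h).trans (le_add_of_nonneg_right (by positivity))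
    · exact (pow_le_pow_right₀ hq0 h).trans (le_add_of_nonneg_left (by positivity))
  have hsum : ((T.filter p).card : ℝ) * (q : ℝ) ^ k ≤ 2 ^ n * T.card := by
    calc ((T.filter p).card : ℝ) * (q : ℝ) ^ k = ∑ W ∈ T.filter p, (q : ℝ) ^ k := by
          rw [Finset.sum_const, nsmul_eq_mul]
      _ ≤ _ := Finset.sum_le_sum hpt
      _ ≤ ∑ W ∈ T, _ := Finset.sum_le_sum_of_subset_of_nonneg (Finset.filter_subset _ _)
          (fun W _ _ => by positivity)
      _ = _ := Finset.sum_add_distrib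
      _ ≤ _ := add_le_add hA hB
      _ = 2 ^ n * T.card := by
          have h2 : (2 : ℝ) ^ n = 2 ^ (n - 1) * 2 := by
            rw [← pow_succ]; congr 1; omega
          rw [h2]; ring
  rw [hden, hnum]
  refine aux_num q n k hq2 hn _ ?_ ?_
  · exact div_le_one_of_le₀ (by exact_mod_cast Finset.card_filter_le _ _) (by positivity)
  · rcases (Nat.cast_nonneg (α := ℝ) T.card).eq_or_lt with h | h
    · rw [← h]; simp
    · rw [div_mul_eq_mul_div, div_le_iff₀ h]; exact hsum
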